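/- arXiv:2508.20026 — 7 statements merged into one kernel-verified Lean document; each statement's English description precedes it below -/
import Mathlib

section
/- Define F : ℕ → ℚ(q) (the field of rational functions over ℚ) by F(0) = 0 and F(n) = q·h_q(n−1)/h_q(n) for n ≥ 1 (the polynomials h_q(m) are nonzero for m ≥ 0, so this is well defined). Then for all n ≥ 0: F(2n+1) = q·F(n) + 1 and F(2n) = q·F(n)/(q·F(n) + 1). (These recurrences show that F(n) equals the Morier-Genoud–Ovsienko q-deformation [CW(n)]_q of the n-th Calkin–Wilf rational CW(n) = fusc(n)/fusc(n+1).) -/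
/-- A multiset of naturals is *hyperbinary* if every element is a power of `2`
and no element occurs more than twice. -/
def IsHyperbinary (μ : Multiset ℕ) : Prop :=
  (∀ x ∈ μ, ∃ i : ℕ, x = 2 ^ i) ∧ ∀ x : ℕ, μ.count x ≤ 2

open scoped Classical in
/-- `hq n` is the length generating function `h_q(n) = Σ_{η ∈ H(n)} q^{ℓ(η)}`
over the hyperbinary partitions of `n`, as a polynomial in `ℤ[q]`. -/
noncomputable def hq (n : ℕ) : Polynomial ℤ :=
  ∑ p ∈ Finset.univ.filter (fun p : n.Partition => IsHyperbinary p.parts),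
      (Polynomial.X : Polynomial ℤ) ^ (Multiset.card p.parts)

/-- `h_q(n)` viewed as an element of the field `ℚ(q)` of rational functions. -/
noncomputable def hqF (n : ℕ) : RatFunc ℚ :=
  algebraMap (Polynomial ℚ) (RatFunc ℚ) ((hq n).map (Int.castRingHom ℚ))

lemma IsHyperbinary.pos {μ : Multiset ℕ} (h : IsHyperbinary μ) {x : ℕ} (hx : x ∈ μ) : 0 < x := by
  obtain ⟨i, rfl⟩ := h.1 x hx
  positivity

/-- The multiset consisting of `k` ones and the doubles of the elements of `ν`. -/
def onesAddDouble (k : ℕ) (ν : Multiset ℕ) : Multiset ℕ :=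
  Multiset.replicate k 1 + ν.map (2 * ·)

lemma double_injective : Function.Injective (2 * · : ℕ → ℕ) := fun a b h => by
  simpa using h

lemma onesAddDouble_injective (k : ℕ) : Function.Injective (onesAddDouble k) :=
  fun _ _ h => Multiset.map_injective double_injective (add_left_cancel h)

lemma sum_onesAddDouble (k : ℕ) (ν : Multiset ℕ) :
    (onesAddDouble k ν).sum = k + 2 * ν.sum := by
  have : (ν.map (2 * ·)).sum = 2 * ν.sum := Multiset.sum_map_mul_left.trans (by simp)
  simp [onesAddDouble, this]

lemma card_onesAddDouble (k : ℕ) (ν : Multiset ℕ) :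
    (onesAddDouble k ν).card = k + ν.card := by
  simp [onesAddDouble]

lemma count_one_onesAddDouble (k : ℕ) (ν : Multiset ℕ) :
    (onesAddDouble k ν).count 1 = k := by
  have : (ν.map (2 * ·)).count 1 = 0 := by
    rw [Multiset.count_eq_zero, Multiset.mem_map]
    rintro ⟨a, -, h⟩
    omega
  simp only [onesAddDouble, Multiset.count_add, Multiset.count_replicate_self, this, add_zero]

lemma count_double_onesAddDouble (k : ℕ) (ν : Multiset ℕ) (x : ℕ) :
    (onesAddDouble k ν).count (2 * x) = ν.count x := by
  have h : (ν.map (2 * ·)).count (2 * x) = ν.count x :=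
    Multiset.count_map_eq_count' _ ν double_injective x
  have h1 : ¬ 1 = 2 * x := by omega
  simp only [onesAddDouble, Multiset.count_add, Multiset.count_replicate, h, h1, if_false,
    zero_add]

lemma isHyperbinary_onesAddDouble {k : ℕ} (hk : k ≤ 2) {ν : Multiset ℕ} (h : IsHyperbinary ν) :
    IsHyperbinary (onesAddDouble k ν) := by
  have hpow : ∀ x ∈ onesAddDouble k ν, ∃ i : ℕ, x = 2 ^ i := by
    intro x hx
    rcases Multiset.mem_add.1 hx with hx | hx
    · exact ⟨0, Multiset.eq_of_mem_replicate hx⟩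
    · obtain ⟨y, hy, rfl⟩ := Multiset.mem_map.1 hx
      obtain ⟨i, rfl⟩ := h.1 y hy
      exact ⟨i + 1, by ring⟩
  refine ⟨hpow, fun x => ?_⟩
  by_cases hx : x ∈ onesAddDouble k ν
  · obtain ⟨i, rfl⟩ := hpow x hx
    cases i with
    | zero => rw [pow_zero, count_one_onesAddDouble]; exact hk
    | succ i => rw [pow_succ', count_double_onesAddDouble]; exact h.2 _
  · simp [Multiset.count_eq_zero_of_notMem hx]

lemma IsHyperbinary.exists_eq_onesAddDouble {μ : Multiset ℕ} (h : IsHyperbinary μ) :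
    ∃ k ≤ 2, ∃ ν, IsHyperbinary ν ∧ μ = onesAddDouble k ν := by
  have hmem : ∀ x ∈ μ.filter (¬ 1 = ·), ∃ i : ℕ, x = 2 * 2 ^ i := by
    intro x hx
    obtain ⟨hx, hne⟩ := Multiset.mem_filter.1 hx
    obtain ⟨i, rfl⟩ := h.1 x hx
    cases i with
    | zero => simp at hne
    | succ i => exact ⟨i, pow_succ' 2 i⟩
  have hμ : μ = onesAddDouble (μ.count 1) ((μ.filter (¬ 1 = ·)).map (· / 2)) := by
    have hdiv : ((μ.filter (¬ 1 = ·)).map (· / 2)).map (2 * ·) = μ.filter (¬ 1 = ·) := by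
      rw [Multiset.map_map]
      refine (Multiset.map_congr rfl fun x hx => ?_).trans (Multiset.map_id' _)
      obtain ⟨i, rfl⟩ := hmem x hx
      simp
    rw [onesAddDouble, hdiv, ← Multiset.filter_eq, Multiset.filter_add_not]
  refine ⟨_, h.2 1, _, ⟨fun x hx => ?_, fun x => ?_⟩, hμ⟩
  · obtain ⟨y, hy, rfl⟩ := Multiset.mem_map.1 hx
    obtain ⟨i, rfl⟩ := hmem y hy
    exact ⟨i, by simp⟩
  · rw [← count_double_onesAddDouble (μ.count 1), ← hμ]
    exact h.2 _

open scoped Classical in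
/-- The hyperbinary partitions of `n`, as a finite set of multisets. -/
noncomputable def hyperbinaryPartitions (n : ℕ) : Finset (Multiset ℕ) :=
  (Finset.univ.filter fun p : n.Partition => IsHyperbinary p.parts).image Nat.Partition.parts

lemma mem_hyperbinaryPartitions {n : ℕ} {μ : Multiset ℕ} :
    μ ∈ hyperbinaryPartitions n ↔ IsHyperbinary μ ∧ μ.sum = n := by
  simp only [hyperbinaryPartitions, Finset.mem_image, Finset.mem_filter, Finset.mem_univ,
    true_and]
  constructor
  · rintro ⟨p, hp, rfl⟩
    exact ⟨hp, p.parts_sum⟩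
  · rintro ⟨h, hs⟩
    exact ⟨⟨μ, h.pos, hs⟩, h, rfl⟩

lemma hq_eq_sum_hyperbinaryPartitions (n : ℕ) :
    hq n = ∑ μ ∈ hyperbinaryPartitions n, (Polynomial.X : Polynomial ℤ) ^ μ.card := by
  rw [hq, hyperbinaryPartitions, Finset.sum_image fun p _ p' _ h => Nat.Partition.ext h]

lemma sum_image_onesAddDouble (k n : ℕ) :
    ∑ μ ∈ (hyperbinaryPartitions n).image (onesAddDouble k),
      (Polynomial.X : Polynomial ℤ) ^ μ.card = Polynomial.X ^ k * hq n := by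
  rw [Finset.sum_image (onesAddDouble_injective k).injOn,
    hq_eq_sum_hyperbinaryPartitions, Finset.mul_sum]
  simp only [card_onesAddDouble, pow_add]

lemma hq_zero : hq 0 = 1 := by
  have : hyperbinaryPartitions 0 = {0} := by
    ext μ
    rw [mem_hyperbinaryPartitions, Finset.mem_singleton]
    constructor
    · rintro ⟨h, hs⟩
      refine Multiset.eq_zero_of_forall_notMem fun x hx => ?_
      exact (h.pos hx).ne' (Multiset.sum_eq_zero_iff.1 hs x hx)
    · rintro rfl
      simp [IsHyperbinary]
  simp [hq_eq_sum_hyperbinaryPartitions, this]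

lemma hq_two_mul_add_one (n : ℕ) : hq (2 * n + 1) = Polynomial.X * hq n := by
  have : hyperbinaryPartitions (2 * n + 1) =
      (hyperbinaryPartitions n).image (onesAddDouble 1) := by
    ext μ
    simp only [mem_hyperbinaryPartitions, Finset.mem_image]
    constructor
    · rintro ⟨h, hs⟩
      obtain ⟨k, hk, ν, hν, rfl⟩ := h.exists_eq_onesAddDouble
      rw [sum_onesAddDouble] at hs
      obtain rfl : k = 1 := by omega
      exact ⟨ν, ⟨hν, by omega⟩, rfl⟩
    · rintro ⟨ν, ⟨hν, rfl⟩, rfl⟩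
      exact ⟨isHyperbinary_onesAddDouble (by norm_num) hν, by rw [sum_onesAddDouble, add_comm]⟩
  rw [hq_eq_sum_hyperbinaryPartitions, this, sum_image_onesAddDouble, pow_one]

lemma hq_two_mul_add_two (n : ℕ) :
    hq (2 * n + 2) = hq (n + 1) + Polynomial.X ^ 2 * hq n := by
  have hunion : hyperbinaryPartitions (2 * n + 2) =
      (hyperbinaryPartitions (n + 1)).image (onesAddDouble 0) ∪
        (hyperbinaryPartitions n).image (onesAddDouble 2) := by
    ext μ
    simp only [mem_hyperbinaryPartitions, Finset.mem_union, Finset.mem_image]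
    constructor
    · rintro ⟨h, hs⟩
      obtain ⟨k, hk, ν, hν, rfl⟩ := h.exists_eq_onesAddDouble
      rw [sum_onesAddDouble] at hs
      obtain rfl | rfl : k = 0 ∨ k = 2 := by omega
      · exact .inl ⟨ν, ⟨hν, by omega⟩, rfl⟩
      · exact .inr ⟨ν, ⟨hν, by omega⟩, rfl⟩
    · rintro (⟨ν, ⟨hν, hs⟩, rfl⟩ | ⟨ν, ⟨hν, hs⟩, rfl⟩)
      all_goals
        refine ⟨isHyperbinary_onesAddDouble (by norm_num) hν, ?_⟩
        rw [sum_onesAddDouble]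
        omega
  have hdisj : Disjoint ((hyperbinaryPartitions (n + 1)).image (onesAddDouble 0))
      ((hyperbinaryPartitions n).image (onesAddDouble 2)) := by
    simp only [Finset.disjoint_left, Finset.mem_image]
    rintro _ ⟨ν, -, rfl⟩ ⟨ν', -, h⟩
    have := congrArg (Multiset.count 1) h
    simp only [count_one_onesAddDouble] at this
    omega
  rw [hq_eq_sum_hyperbinaryPartitions, hunion, Finset.sum_union hdisj, sum_image_onesAddDouble,
    sum_image_onesAddDouble, pow_zero, one_mul]

lemma eval_one_hq_pos (n : ℕ) : 0 < (hq n).eval 1 := by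
  induction n using Nat.strong_induction_on with
  | _ n ih =>
    rcases Nat.even_or_odd' n with ⟨m, rfl | rfl⟩
    · cases m with
      | zero => simp [hq_zero]
      | succ m =>
        have h1 := ih (m + 1) (by omega)
        have h2 := ih m (by omega)
        rw [show 2 * (m + 1) = 2 * m + 2 by ring, hq_two_mul_add_two]
        simpa using add_pos h1 h2
    · simpa [hq_two_mul_add_one] using ih m (by omega)

lemma hqF_ne_zero (n : ℕ) : hqF n ≠ 0 := by
  have h : hq n ≠ 0 := fun h => by simpa [h] using eval_one_hq_pos n
  rw [hqF, Ne, FaithfulSMul.algebraMap_eq_zero_iff,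
    Polynomial.map_eq_zero_iff (RingHom.injective_int _)]
  exact h

lemma hqF_zero : hqF 0 = 1 := by
  simp [hqF, hq_zero]

lemma hqF_two_mul_add_one (n : ℕ) : hqF (2 * n + 1) = RatFunc.X * hqF n := by
  simp [hqF, hq_two_mul_add_one]

lemma hqF_two_mul_add_two (n : ℕ) :
    hqF (2 * n + 2) = hqF (n + 1) + RatFunc.X ^ 2 * hqF n := by
  simp [hqF, hq_two_mul_add_two]


/-- Let `F : ℕ → ℚ(q)` be defined by `F 0 = 0` and `F n = q · h_q(n-1) / h_q(n)` for
`n ≥ 1`. Then `F(2n+1) = q·F(n) + 1` and `F(2n) = q·F(n) / (q·F(n) + 1)` for all `n`;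
these recurrences show `F(n) = [CW(n)]_q`, the Morier-Genoud–Ovsienko `q`-deformation
of the `n`-th Calkin–Wilf rational. -/
theorem qCalkinWilf_recurrences (F : ℕ → RatFunc ℚ) (hF0 : F 0 = 0)
    (hF : ∀ n : ℕ, 1 ≤ n → F n = RatFunc.X * hqF (n - 1) / hqF n) :
    ∀ n : ℕ,
      F (2 * n + 1) = RatFunc.X * F n + 1 ∧
      F (2 * n) = RatFunc.X * F n / (RatFunc.X * F n + 1) := by
  have hX : (RatFunc.X : RatFunc ℚ) ≠ 0 := RatFunc.X_ne_zero
  intro n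
  cases n with
  | zero =>
    have h1 := hqF_two_mul_add_one 0
    rw [mul_zero, zero_add, hqF_zero, mul_one] at h1
    simp [hF0, hF 1 le_rfl, h1, hqF_zero, hX]
  | succ m =>
    have hm := hqF_ne_zero (m + 1)
    have heven := hqF_two_mul_add_two m
    have hne := hqF_ne_zero (2 * m + 2)
    have hden : RatFunc.X * F (m + 1) + 1 = hqF (2 * m + 2) / hqF (m + 1) := by
      rw [hF (m + 1) (by omega), heven, Nat.add_sub_cancel]
      field_simp
      ring
    constructor
    · rw [hden, hF _ (by omega), Nat.add_sub_cancel, hqF_two_mul_add_one,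
        mul_div_mul_left _ _ hX, mul_add, mul_one]
    · rw [hden, hF (2 * (m + 1)) (by omega), hF (m + 1) (by omega),
        show 2 * (m + 1) - 1 = 2 * m + 1 by omega, Nat.add_sub_cancel, hqF_two_mul_add_one,
        mul_add, mul_one]
      field_simp
end

section
/- In the polynomial ring ℤ[r,s]: H_{rs}(−1) = 0, H_{rs}(0) = 1, and for all n ≥ 1, H_{rs}(2n−1) = H_{rs}(n−1) and H_{rs}(2n) = s·H_{rs}(n) + r·H_{rs}(n−1). Moreover, for all n ≥ 1, M'(n)·(1,1)ᵀ = (H_{rs}(n−1), H_{rs}(n))ᵀ. -/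
/-- The indeterminate `r` of `ℤ[r,s]`, realized as `MvPolynomial (Fin 2) ℤ`. -/
noncomputable def rv : MvPolynomial (Fin 2) ℤ := MvPolynomial.X 0

/-- The indeterminate `s` of `ℤ[r,s]`, realized as `MvPolynomial (Fin 2) ℤ`. -/
noncomputable def sv : MvPolynomial (Fin 2) ℤ := MvPolynomial.X 1

/-- `DExp n` is the (finite) set `D(n)` of hyperbinary expansions of `n`: words
`d = d_1 … d_k` with digits in `{0,1,2}`, of length `k = Nat.size n`, with
`Σ_i d_i 2^(k-i) = n`. -/
def DExp (n : ℕ) : Finset (Fin (Nat.size n) → Fin 3) :=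
  Finset.univ.filter (fun d => ∑ i, (d i : ℕ) * 2 ^ (Nat.size n - 1 - (i : ℕ)) = n)

/-- `t(d)` : the number of digits of `d` equal to `2`. -/
def twos {k : ℕ} (d : Fin k → Fin 3) : ℕ :=
  (Finset.univ.filter (fun i => d i = 2)).card

/-- `z(d)` : the number of zeros of `d` lying strictly to the right of the leftmost
nonzero digit of `d`. -/
def zrs {k : ℕ} (d : Fin k → Fin 3) : ℕ :=
  (Finset.univ.filter (fun i => d i = 0 ∧ ∃ j, j < i ∧ d j ≠ 0)).card

/-- `H_{rs}(n) = Σ_{d ∈ D(n)} r^{t(d)} s^{z(d)} ∈ ℤ[r,s]` (for `n = 0` this gives `1`). -/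
noncomputable def Hrs (n : ℕ) : MvPolynomial (Fin 2) ℤ :=
  ∑ d ∈ DExp n, rv ^ twos d * sv ^ zrs d

/-- `H_{rs}` for an integer index, with the convention that it vanishes for
negative arguments. -/
noncomputable def HrsZ (m : ℤ) : MvPolynomial (Fin 2) ℤ :=
  if 0 ≤ m then Hrs m.toNat else 0

/-- The matrix `L' = [[1, 0], [r, s]]` over `ℤ[r,s]`. -/
noncomputable def Lmat' : Matrix (Fin 2) (Fin 2) (MvPolynomial (Fin 2) ℤ) :=
  !![1, 0; rv, sv]

/-- The matrix `R' = [[r, s], [0, 1]]` over `ℤ[r,s]`. -/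
noncomputable def Rmat' : Matrix (Fin 2) (Fin 2) (MvPolynomial (Fin 2) ℤ) :=
  !![rv, sv; 0, 1]

/-- `Mmat' n` is the product of the matrices obtained by reading the reversed binary
expansion `b_k b_{k-1} … b_2` of `n` (dropping the leading digit `b_1 = 1`) and
replacing each `0` by `L'` and each `1` by `R'`; it is the identity when `n ≤ 1`. -/
noncomputable def Mmat' (n : ℕ) : Matrix (Fin 2) (Fin 2) (MvPolynomial (Fin 2) ℤ) :=
  if _h : n ≤ 1 then 1
  else (if n % 2 = 0 then Lmat' else Rmat') * Mmat' (n / 2)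
termination_by n
decreasing_by exact Nat.div_lt_self (by omega) (by omega)

/-- The number represented in base two by the word `d`. -/
def wordValue {k : ℕ} (d : Fin k → Fin 3) : ℕ :=
  ∑ i, (d i : ℕ) * 2 ^ (k - 1 - (i : ℕ))

/-- The generating polynomial of the hyperbinary expansions of `n` of length `k`. -/
noncomputable def HrsLength (k n : ℕ) : MvPolynomial (Fin 2) ℤ :=
  ∑ d : Fin k → Fin 3, if wordValue d = n then rv ^ twos d * sv ^ zrs d else 0

theorem Hrs_eq_HrsLength_size (n : ℕ) : Hrs n = HrsLength n.size n := by
  rw [Hrs, DExp, Finset.sum_filter]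
  rfl

theorem wordValue_snoc {k : ℕ} (d : Fin k → Fin 3) (x : Fin 3) :
    wordValue (Fin.snoc d x : Fin (k + 1) → Fin 3) = 2 * wordValue d + x := by
  simp only [wordValue, Fin.sum_univ_castSucc, Fin.snoc_castSucc, Fin.snoc_last,
    Fin.val_castSucc, Fin.val_last, Finset.mul_sum, Nat.add_sub_cancel, Nat.sub_self,
    pow_zero, mul_one]
  congr 1
  refine Finset.sum_congr rfl fun i _ => ?_
  have h : k - i = (k - 1 - i) + 1 := by omega
  rw [h, pow_succ]
  ring

theorem wordValue_eq_zero_iff {k : ℕ} (d : Fin k → Fin 3) :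
    wordValue d = 0 ↔ ∀ i, d i = 0 := by
  simp [wordValue, Finset.sum_eq_zero_iff]

theorem twos_snoc {k : ℕ} (d : Fin k → Fin 3) (x : Fin 3) :
    twos (Fin.snoc d x : Fin (k + 1) → Fin 3) = twos d + if x = 2 then 1 else 0 := by
  simp only [twos, Finset.card_filter, Fin.sum_univ_castSucc, Fin.snoc_castSucc, Fin.snoc_last]

theorem zrs_snoc {k : ℕ} (d : Fin k → Fin 3) (x : Fin 3) :
    zrs (Fin.snoc d x : Fin (k + 1) → Fin 3) =
      zrs d + if x = 0 ∧ wordValue d ≠ 0 then 1 else 0 := by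
  simp only [zrs, Finset.card_filter, Fin.sum_univ_castSucc, Fin.exists_fin_succ',
    Fin.snoc_castSucc, Fin.snoc_last, Fin.castSucc_lt_castSucc_iff, Fin.castSucc_lt_last,
    lt_irrefl, (Fin.castSucc_lt_last _).not_gt, false_and, or_false,
    true_and, ne_eq, wordValue_eq_zero_iff, not_forall]

theorem HrsLength_succ (k n : ℕ) :
    HrsLength (k + 1) n = ∑ x : Fin 3, ∑ d : Fin k → Fin 3,
      if 2 * wordValue d + x = n then
        rv ^ (twos d + if x = 2 then 1 else 0) *
          sv ^ (zrs d + if x = 0 ∧ wordValue d ≠ 0 then 1 else 0)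
      else 0 := by
  rw [HrsLength, ← (Fin.snocEquiv fun _ => Fin 3).sum_comp, Fintype.sum_prod_type]
  simp only [Fin.snocEquiv, Equiv.coe_fn_mk, wordValue_snoc, twos_snoc, zrs_snoc]

theorem HrsLength_succ_odd (k m : ℕ) : HrsLength (k + 1) (2 * m + 1) = HrsLength k m := by
  rw [HrsLength_succ, Fin.sum_univ_three, HrsLength]
  have h0 (v : ℕ) : ¬ 2 * v = 2 * m + 1 := by omega
  have h2 (v : ℕ) : ¬ 2 * v + 2 = 2 * m + 1 := by omega
  simp [h0, h2]

theorem HrsLength_succ_even (k m : ℕ) (hm : 1 ≤ m) :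
    HrsLength (k + 1) (2 * m) = sv * HrsLength k m + rv * HrsLength k (m - 1) := by
  rw [HrsLength_succ, Fin.sum_univ_three]
  have h1 (v : ℕ) : ¬ 2 * v + 1 = 2 * m := by omega
  have h2 (v : ℕ) : 2 * v + 2 = 2 * m ↔ v = m - 1 := by omega
  simp only [HrsLength, Finset.mul_sum]
  simp only [Fin.val_zero, Fin.val_one, Fin.val_two, h1, h2, if_false, Finset.sum_const_zero,
    add_zero]
  congr 1 <;> refine Finset.sum_congr rfl fun d _ => ?_
  · by_cases h : wordValue d = m
    · simp only [h, true_and, if_true]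
      rw [if_neg (by decide), if_pos (by omega)]
      ring
    · simp [h]
  · by_cases h : wordValue d = m - 1
    · simp [h]
      ring
    · simp [h]

theorem HrsLength_succ_zero (k : ℕ) : HrsLength (k + 1) 0 = HrsLength k 0 := by
  rw [HrsLength_succ, Fin.sum_univ_three, HrsLength]
  simp +contextual

theorem HrsLength_zero_right (k : ℕ) : HrsLength k 0 = 1 := by
  induction k with
  | zero => simp [HrsLength, wordValue, twos, zrs]
  | succ k ih => rw [HrsLength_succ_zero, ih]

theorem HrsLength_succ_of_lt {k n : ℕ} (h : n < 2 ^ k) :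
    HrsLength (k + 1) n = HrsLength k n := by
  induction k generalizing n with
  | zero =>
    obtain rfl : n = 0 := by simpa using h
    exact HrsLength_succ_zero 0
  | succ k ih =>
    rw [pow_succ] at h
    obtain ⟨m, rfl | rfl⟩ := Nat.even_or_odd' n
    · obtain rfl | hm := Nat.eq_zero_or_pos m
      · exact HrsLength_succ_zero _
      · rw [HrsLength_succ_even _ _ hm, HrsLength_succ_even _ _ hm, ih (by omega), ih (by omega)]
    · rw [HrsLength_succ_odd, HrsLength_succ_odd, ih (by omega)]

theorem HrsLength_eq_Hrs {k n : ℕ} (h : n < 2 ^ k) : HrsLength k n = Hrs n := by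
  rw [Hrs_eq_HrsLength_size]
  induction k, Nat.size_le.2 h using Nat.le_induction with
  | base => rfl
  | succ k hk ih => rw [HrsLength_succ_of_lt (Nat.size_le.1 hk), ih (Nat.size_le.1 hk)]

theorem Hrs_zero : Hrs 0 = 1 := by
  rw [Hrs_eq_HrsLength_size, HrsLength_zero_right]

theorem Hrs_odd (m : ℕ) : Hrs (2 * m + 1) = Hrs m := by
  have h : m < 2 ^ m := Nat.lt_two_pow_self
  rw [← HrsLength_eq_Hrs (k := m + 1) (by rw [pow_succ]; omega), HrsLength_succ_odd,
    HrsLength_eq_Hrs h]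

theorem Hrs_even (m : ℕ) (hm : 1 ≤ m) :
    Hrs (2 * m) = sv * Hrs m + rv * Hrs (m - 1) := by
  have h : m < 2 ^ m := Nat.lt_two_pow_self
  rw [← HrsLength_eq_Hrs (k := m + 1) (by rw [pow_succ]; omega), HrsLength_succ_even _ _ hm,
    HrsLength_eq_Hrs h, HrsLength_eq_Hrs (by omega)]

theorem Mmat'_mulVec_one (n : ℕ) (hn : 1 ≤ n) :
    (Mmat' n).mulVec ![1, 1] = ![Hrs (n - 1), Hrs n] := by
  induction n using Nat.strong_induction_on with
  | _ n ih =>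
    obtain rfl | h1 := hn.eq_or_lt
    · have h : Hrs 1 = 1 := by simpa [Hrs_zero] using Hrs_odd 0
      rw [Mmat']
      simp [Hrs_zero, h]
    · rw [Mmat', dif_neg (by omega), ← Matrix.mulVec_mulVec, ih (n / 2) (by omega) (by omega)]
      obtain ⟨m, rfl | rfl⟩ := Nat.even_or_odd' n
      · have hm : 2 * m - 1 = 2 * (m - 1) + 1 := by omega
        rw [if_pos (by omega), Hrs_even m (by omega), hm, Hrs_odd,
          Nat.mul_div_cancel_left m two_pos]
        ext i
        fin_cases i <;> simp [Lmat', Matrix.mulVec, dotProduct, add_comm]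
      · have hm : (2 * m + 1) / 2 = m := by omega
        rw [if_neg (by omega), hm, Hrs_odd, Nat.add_sub_cancel, Hrs_even m (by omega)]
        ext i
        fin_cases i <;> simp [Rmat', Matrix.mulVec, dotProduct, add_comm]

/-- In `ℤ[r,s]`: `H_{rs}(-1) = 0`, `H_{rs}(0) = 1`, and for `n ≥ 1` the recurrences
`H_{rs}(2n-1) = H_{rs}(n-1)` and `H_{rs}(2n) = s·H_{rs}(n) + r·H_{rs}(n-1)` hold;
moreover `M'(n)·(1,1)ᵀ = (H_{rs}(n-1), H_{rs}(n))ᵀ` for all `n ≥ 1`. -/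
theorem Hrs_recurrences_and_Mmat' :
    HrsZ (-1) = 0 ∧ HrsZ 0 = 1 ∧
    (∀ n : ℕ, 1 ≤ n →
      Hrs (2 * n - 1) = Hrs (n - 1) ∧
      Hrs (2 * n) = sv * Hrs n + rv * Hrs (n - 1)) ∧
    (∀ n : ℕ, 1 ≤ n →
      (Mmat' n).mulVec ![1, 1] = ![Hrs (n - 1), Hrs n]) := by
  refine ⟨by simp [HrsZ], by simp [HrsZ, Hrs_zero], fun n hn => ⟨?_, Hrs_even n hn⟩,
    Mmat'_mulVec_one⟩
  have h : 2 * n - 1 = 2 * (n - 1) + 1 := by omega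
  rw [h, Hrs_odd]
end

section
/- For all n ≥ 1: (i) the map η ↦ 2η + (1) (double every part of η, then adjoin one part equal to 1) is a bijection from H(n−1) onto H(2n−1); (ii) H(2n) is the disjoint union of {2η : η ∈ H(n)} and {2η + (1,1) : η ∈ H(n−1)}, where 2η doubles every part of η and adjoining (1,1) adds two parts equal to 1. Also H(0) consists exactly of the empty partition. -/
/-- `H(n)`, the set of hyperbinary partitions of `n`, realized as multisets of naturals:
every part is a power of `2`, every part occurs at most twice, and the parts sum to `n`. -/
def HypSet (n : ℕ) : Set (Multiset ℕ) :=
  {μ | μ.sum = n ∧ (∀ x ∈ μ, ∃ i : ℕ, x = 2 ^ i) ∧ ∀ x : ℕ, μ.count x ≤ 2}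

theorem sum_replicate_one_add_map_two_mul (k : ℕ) (η : Multiset ℕ) :
    (Multiset.replicate k 1 + η.map (fun x => 2 * x)).sum = k + 2 * η.sum := by
  rw [Multiset.sum_add, Multiset.sum_replicate, smul_eq_mul, mul_one, Multiset.sum_map_mul_left,
    Multiset.map_id']

theorem count_replicate_one_add_map_two_mul_even (k : ℕ) (η : Multiset ℕ) (x : ℕ) :
    (Multiset.replicate k 1 + η.map (fun x => 2 * x)).count (2 * x) = η.count x := by
  have h : (1 : ℕ) ≠ 2 * x := by omega
  rw [Multiset.count_add, Multiset.count_replicate, if_neg h, zero_add]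
  exact Multiset.count_map_eq_count' _ _ (mul_right_injective₀ two_ne_zero) x

theorem count_replicate_one_add_map_two_mul_odd (k : ℕ) (η : Multiset ℕ) (x : ℕ) :
    (Multiset.replicate k 1 + η.map (fun x => 2 * x)).count (2 * x + 1) =
      if 1 = 2 * x + 1 then k else 0 := by
  have h : 2 * x + 1 ∉ η.map (fun x => 2 * x) := by
    simp only [Multiset.mem_map, not_exists, not_and]
    omega
  rw [Multiset.count_add, Multiset.count_replicate, Multiset.count_eq_zero_of_notMem h, add_zero]

/-- Adjoining `k` ones to `2η` gives a hyperbinary partition exactly when `k ≤ 2` and `η` is one. -/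
theorem replicate_one_add_map_two_mul_mem_hypSet_iff {k n : ℕ} {η : Multiset ℕ} :
    Multiset.replicate k 1 + η.map (fun x => 2 * x) ∈ HypSet (k + 2 * n) ↔
      k ≤ 2 ∧ η ∈ HypSet n := by
  have hsum := sum_replicate_one_add_map_two_mul k η
  constructor
  · rintro ⟨hs, hp, hc⟩
    refine ⟨?_, by omega, fun x hx => ?_, fun x => ?_⟩
    · have h := hc (2 * 0 + 1)
      rwa [count_replicate_one_add_map_two_mul_odd, if_pos (by norm_num)] at h
    · obtain ⟨i, hi⟩ :=
        hp (2 * x) (Multiset.mem_add.2 (Or.inr (Multiset.mem_map_of_mem (fun x => 2 * x) hx)))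
      cases i with
      | zero => omega
      | succ i => exact ⟨i, by rw [pow_succ] at hi; omega⟩
    · rw [← count_replicate_one_add_map_two_mul_even k η x]
      exact hc _
  · rintro ⟨hk, hs, hp, hc⟩
    refine ⟨by omega, fun x hx => ?_, fun x => ?_⟩
    · rcases Multiset.mem_add.1 hx with hx | hx
      · exact ⟨0, Multiset.eq_of_mem_replicate hx⟩
      · obtain ⟨y, hy, rfl⟩ := Multiset.mem_map.1 hx
        obtain ⟨i, rfl⟩ := hp y hy
        exact ⟨i + 1, (pow_succ' 2 i).symm⟩
    · obtain ⟨y, rfl | rfl⟩ := x.even_or_odd'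
      · rw [count_replicate_one_add_map_two_mul_even]
        exact hc y
      · rw [count_replicate_one_add_map_two_mul_odd]
        split_ifs <;> omega

/-- Every hyperbinary partition consists of at most two ones and a doubled hyperbinary partition. -/
theorem exists_eq_replicate_one_add_map_two_mul {m : ℕ} {μ : Multiset ℕ} (hμ : μ ∈ HypSet m) :
    ∃ k n η, k ≤ 2 ∧ m = k + 2 * n ∧ η ∈ HypSet n ∧
      μ = Multiset.replicate k 1 + η.map (fun x => 2 * x) := by
  set η := (μ.filter (fun x => ¬ x = 1)).map (fun x => x / 2) with hη
  have hmap : η.map (fun x => 2 * x) = μ.filter (fun x => ¬ x = 1) := by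
    rw [hη, Multiset.map_map]
    refine (Multiset.map_congr rfl fun x hx => ?_).trans (Multiset.map_id _)
    obtain ⟨hx, hx1⟩ := Multiset.mem_filter.1 hx
    obtain ⟨i, rfl⟩ := hμ.2.1 x hx
    cases i with
    | zero => exact absurd (pow_zero 2) hx1
    | succ i => simp [pow_succ']
  have heq : μ = Multiset.replicate (μ.count 1) 1 + η.map (fun x => 2 * x) := by
    rw [hmap, ← Multiset.filter_eq', Multiset.filter_add_not]
  have hm : m = μ.count 1 + 2 * η.sum := by
    rw [← hμ.1]
    conv_lhs => rw [heq]
    exact sum_replicate_one_add_map_two_mul _ _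
  have hmem := hμ
  rw [heq, hm] at hmem
  obtain ⟨hk, hη'⟩ := replicate_one_add_map_two_mul_mem_hypSet_iff.1 hmem
  exact ⟨_, _, η, hμ.2.2 1, hm, hη', heq⟩

theorem hypSet_zero : HypSet 0 = {0} := by
  ext μ
  constructor
  · rintro ⟨hs, hp, -⟩
    refine Multiset.eq_zero_of_forall_notMem fun x hx => ?_
    obtain ⟨i, rfl⟩ := hp x hx
    have h := Multiset.le_sum_of_mem hx
    have := Nat.two_pow_pos i
    omega
  · rintro rfl
    simp [HypSet]

/-- For all `n ≥ 1`: (i) `η ↦ 2η + (1)` is a bijection from `H(n-1)` onto `H(2n-1)`;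
(ii) `H(2n)` is the disjoint union of `{2η : η ∈ H(n)}` and
`{2η + (1,1) : η ∈ H(n-1)}`. Also `H(0)` consists exactly of the empty partition. -/
theorem hypSet_recursive_structure :
    (∀ n : ℕ, 1 ≤ n →
      Set.BijOn (fun μ : Multiset ℕ => 1 ::ₘ μ.map (fun x => 2 * x))
        (HypSet (n - 1)) (HypSet (2 * n - 1)) ∧
      HypSet (2 * n) =
        ((fun μ : Multiset ℕ => μ.map (fun x => 2 * x)) '' HypSet n) ∪
        ((fun μ : Multiset ℕ => 1 ::ₘ 1 ::ₘ μ.map (fun x => 2 * x)) '' HypSet (n - 1)) ∧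
      Disjoint
        ((fun μ : Multiset ℕ => μ.map (fun x => 2 * x)) '' HypSet n)
        ((fun μ : Multiset ℕ => 1 ::ₘ 1 ::ₘ μ.map (fun x => 2 * x)) '' HypSet (n - 1))) ∧
    HypSet 0 = {0} := by
  refine ⟨fun n hn => ⟨⟨fun η hη => ?_, fun η _ η' _ h => ?_, fun μ hμ => ?_⟩, ?_, ?_⟩, hypSet_zero⟩
  · have h := replicate_one_add_map_two_mul_mem_hypSet_iff.2 ⟨one_le_two, hη⟩
    rwa [show 1 + 2 * (n - 1) = 2 * n - 1 by omega] at h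
  · exact Multiset.map_injective (mul_right_injective₀ two_ne_zero) ((Multiset.cons_inj_right 1).1 h)
  · obtain ⟨k, m, η, hk, hm, hη, rfl⟩ := exists_eq_replicate_one_add_map_two_mul hμ
    obtain rfl : k = 1 := by omega
    obtain rfl : m = n - 1 := by omega
    exact ⟨η, hη, rfl⟩
  · ext μ
    constructor
    · intro hμ
      obtain ⟨k, m, η, hk, hm, hη, rfl⟩ := exists_eq_replicate_one_add_map_two_mul hμ
      obtain rfl | rfl : k = 0 ∨ k = 2 := by omega
      · obtain rfl : m = n := by omega
        exact Or.inl ⟨η, hη, by simp⟩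
      · obtain rfl : m = n - 1 := by omega
        exact Or.inr ⟨η, hη, by simp [Multiset.replicate_succ]⟩
    · rintro (⟨η, hη, rfl⟩ | ⟨η, hη, rfl⟩)
      · simpa using replicate_one_add_map_two_mul_mem_hypSet_iff.2 ⟨zero_le_two, hη⟩
      · have h := replicate_one_add_map_two_mul_mem_hypSet_iff.2 ⟨le_rfl, hη⟩
        rw [show 2 + 2 * (n - 1) = 2 * n by omega] at h
        simpa [Multiset.replicate_succ] using h
  · rw [Set.disjoint_left]
    rintro _ ⟨η, -, rfl⟩ ⟨η', -, h⟩
    have h1 : 1 ∈ η.map (fun x => 2 * x) := by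
      beta_reduce at h
      rw [← h]
      exact Multiset.mem_cons_self 1 _
    obtain ⟨x, -, hx⟩ := Multiset.mem_map.1 h1
    omega
end

section
/- For every n ≥ 1, the binary expansion β(n) of n is the maximum element of the poset D(n): every hyperbinary expansion d ∈ D(n) satisfies d ≤ β(n) in the refinement order. -/
/-- `d : Fin (Nat.size n) → ℕ` is a hyperbinary expansion `d_1 … d_k` of `n`
(indexed from `0`, so `d i` is the coefficient of `2^(k-1-i)` where `k = Nat.size n`
is the number of binary digits of `n`): all digits are at most `2` and
`Σ_i d_i 2^(k-1-i) = n`. -/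
def IsHypExp (n : ℕ) (d : Fin (Nat.size n) → ℕ) : Prop :=
  (∀ i, d i ≤ 2) ∧ ∑ i, d i * 2 ^ (Nat.size n - 1 - (i : ℕ)) = n

/-- `ElemMove d c` : the word `c` is obtained from `d` by one elementary move,
replacing an adjacent pair `(d i, d (i+1)) = (a, 0)` with `a > 0` by `(a - 1, 2)`. -/
def ElemMove {k : ℕ} (d c : Fin k → ℕ) : Prop :=
  ∃ (i j : Fin k), (j : ℕ) = (i : ℕ) + 1 ∧ 0 < d i ∧ d j = 0 ∧
    c i = d i - 1 ∧ c j = 2 ∧ ∀ t, t ≠ i → t ≠ j → c t = d t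

/-- The refinement order on hyperbinary expansions: `HypLe c d` iff `c` can be obtained
from `d` by a (possibly empty) sequence of elementary moves; it is the
reflexive-transitive closure of the elementary-move relation. -/
def HypLe {k : ℕ} (c d : Fin k → ℕ) : Prop :=
  Relation.ReflTransGen (fun x y => ElemMove y x) c d

/-- `bdigit n i` is the binary digit `b_{i+1}` of `β(n) = b_1 … b_k` (so `i` is
`0`-indexed from the most significant digit, `k = Nat.size n`). -/
def bdigit (n i : ℕ) : ℕ := n / 2 ^ (Nat.size n - 1 - i) % 2

/-- The binary expansion of `n` as a word of length `Nat.size n`. -/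
def bword (n : ℕ) : Fin (Nat.size n) → ℕ := fun i => bdigit n (i : ℕ)

/-- The value of a word splits off its last digit. -/
theorem sum_digits_succ {k : ℕ} (d : Fin (k + 1) → ℕ) :
    ∑ i, d i * 2 ^ (k + 1 - 1 - (i : ℕ)) =
      2 * ∑ i : Fin k, d i.castSucc * 2 ^ (k - 1 - (i : ℕ)) + d (Fin.last k) := by
  rw [Fin.sum_univ_castSucc, Finset.mul_sum]
  congr 1
  · refine Finset.sum_congr rfl fun i _ => ?_
    have h : k + 1 - 1 - (i.castSucc : ℕ) = (k - 1 - (i : ℕ)) + 1 := by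
      have := i.isLt
      simp only [Fin.val_castSucc]
      omega
    rw [h, pow_succ]
    ring
  · simp

theorem div_two_pow_castSucc {k : ℕ} (n : ℕ) (i : Fin k) :
    n / 2 ^ (k + 1 - 1 - (i.castSucc : ℕ)) = n / 2 / 2 ^ (k - 1 - (i : ℕ)) := by
  have h : k + 1 - 1 - (i.castSucc : ℕ) = (k - 1 - (i : ℕ)) + 1 := by
    have := i.isLt
    simp only [Fin.val_castSucc]
    omega
  rw [h, pow_succ', Nat.div_div_eq_div_mul]

theorem sum_binary_digits (k n : ℕ) (hn : n < 2 ^ k) :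
    ∑ i : Fin k, n / 2 ^ (k - 1 - (i : ℕ)) % 2 * 2 ^ (k - 1 - (i : ℕ)) = n := by
  induction k generalizing n with
  | zero => simp at hn; simp [hn]
  | succ k ih =>
    rw [sum_digits_succ fun i : Fin (k + 1) => n / 2 ^ (k + 1 - 1 - (i : ℕ)) % 2]
    simp only [div_two_pow_castSucc]
    rw [ih (n / 2) (by rw [pow_succ] at hn; omega)]
    simp
    omega

/-- A word in the digits `0` and `1` is the binary expansion of its value. -/
theorem eq_binary_digit_of_le_one (k n : ℕ) (d : Fin k → ℕ) (hd : ∀ i, d i ≤ 1)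
    (hs : ∑ i, d i * 2 ^ (k - 1 - (i : ℕ)) = n) (i : Fin k) :
    d i = n / 2 ^ (k - 1 - (i : ℕ)) % 2 := by
  induction k generalizing n with
  | zero => exact i.elim0
  | succ k ih =>
    rw [sum_digits_succ] at hs
    have hl := hd (Fin.last k)
    induction i using Fin.lastCases with
    | last => simp; omega
    | cast i =>
      rw [div_two_pow_castSucc]
      exact ih (n / 2) (fun i => d i.castSucc) (fun i => hd _) (by omega) i

theorem sum_eq_add_add_sum_erase {k : ℕ} (f : Fin k → ℕ) {i j : Fin k} (hij : j ≠ i) :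
    ∑ t, f t = f i + (f j + ∑ t ∈ (Finset.univ.erase i).erase j, f t) := by
  rw [Finset.add_sum_erase _ _ (by simp [hij]), Finset.add_sum_erase _ _ (by simp)]

/-- A word with a digit `2` and a value less than `2 ^ k` is obtained by an elementary move
from a word with the same value and a smaller sum of digits. -/
theorem exists_elemMove {k : ℕ} (d : Fin k → ℕ) (hd : ∀ i, d i ≤ 2)
    (hs : ∑ i, d i * 2 ^ (k - 1 - (i : ℕ)) < 2 ^ k) (h2 : ∃ i, d i = 2) :
    ∃ e : Fin k → ℕ, ElemMove e d ∧ (∀ i, e i ≤ 2) ∧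
      ∑ i, e i * 2 ^ (k - 1 - (i : ℕ)) = ∑ i, d i * 2 ^ (k - 1 - (i : ℕ)) ∧
      ∑ i, e i < ∑ i, d i := by
  obtain ⟨j, hj, hmin⟩ : ∃ j, d j = 2 ∧ ∀ i < j, d i ≠ 2 := by
    obtain ⟨j, hj⟩ := h2
    induction j using WellFoundedLT.induction with
    | ind j ih =>
      by_cases h : ∃ i < j, d i = 2
      · obtain ⟨i, hi, hdi⟩ := h
        exact ih i hi hdi
      · push Not at h
        exact ⟨j, hj, h⟩
  have hjk := j.isLt
  have hj0 : (j : ℕ) ≠ 0 := by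
    intro h0
    have hle := Finset.single_le_sum (f := fun i : Fin k => d i * 2 ^ (k - 1 - (i : ℕ)))
      (fun i _ => Nat.zero_le _) (Finset.mem_univ j)
    simp only [hj, h0, Nat.sub_zero] at hle
    rw [← pow_succ', Nat.sub_add_cancel (by omega)] at hle
    omega
  let i : Fin k := ⟨(j : ℕ) - 1, by omega⟩
  have hi : (i : ℕ) = (j : ℕ) - 1 := rfl
  have hij : j ≠ i := by
    intro h
    have := congrArg Fin.val h
    omega
  have hdi : d i ≤ 1 := by
    have h1 := hmin i (by rw [Fin.lt_def]; omega)
    have := hd i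
    omega
  let e : Fin k → ℕ := fun t => if t = i then d i + 1 else if t = j then 0 else d t
  have hei : e i = d i + 1 := by simp [e]
  have hej : e j = 0 := by simp [e, hij]
  have het : ∀ t, t ≠ i → t ≠ j → e t = d t := fun t h1 h2 => by simp [e, h1, h2]
  refine ⟨e, ⟨i, j, by omega, by omega, hej, by omega, hj, fun t h1 h2 => (het t h1 h2).symm⟩,
    fun t => ?_, ?_, ?_⟩
  · by_cases h1 : t = i
    · subst h1; omega
    · by_cases h2 : t = j
      · subst h2; omega
      · rw [het t h1 h2]; exact hd t
  · rw [sum_eq_add_add_sum_erase _ hij, sum_eq_add_add_sum_erase (fun t => d t * _) hij, hei, hej, hj,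
      Finset.sum_congr rfl fun t ht => by
        simp only [Finset.mem_erase] at ht
        rw [het t ht.2.1 ht.1]]
    have hp : k - 1 - (i : ℕ) = (k - 1 - (j : ℕ)) + 1 := by omega
    rw [hp, pow_succ]
    ring
  · have hrest : ∑ t ∈ (Finset.univ.erase i).erase j, e t =
        ∑ t ∈ (Finset.univ.erase i).erase j, d t :=
      Finset.sum_congr rfl fun t ht => by
        simp only [Finset.mem_erase] at ht
        exact het t ht.2.1 ht.1
    have := sum_eq_add_add_sum_erase e hij
    have := sum_eq_add_add_sum_erase d hij
    omega

theorem hypLe_binary_digits (k n : ℕ) (hn : n < 2 ^ k) (d : Fin k → ℕ) (hd : ∀ i, d i ≤ 2)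
    (hs : ∑ i, d i * 2 ^ (k - 1 - (i : ℕ)) = n) :
    HypLe d fun i => n / 2 ^ (k - 1 - (i : ℕ)) % 2 := by
  induction hm : ∑ i, d i using Nat.strong_induction_on generalizing d with
  | h m ih =>
    by_cases h2 : ∃ i, d i = 2
    · obtain ⟨e, hed, he, hes, hlt⟩ := exists_elemMove d hd (hs ▸ hn) h2
      exact Relation.ReflTransGen.head hed (ih _ (hm ▸ hlt) e he (hes.trans hs) rfl)
    · push Not at h2
      have h1 : ∀ i, d i ≤ 1 := fun i => by
        have := hd i
        have := h2 i
        omega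
      rw [← funext (eq_binary_digit_of_le_one k n d h1 hs)]
      exact Relation.ReflTransGen.refl

/-- For every `n ≥ 1`, the binary expansion `β(n)` is the maximum element of `D(n)`:
it is a hyperbinary expansion of `n`, and every `d ∈ D(n)` satisfies `d ≤ β(n)` in
the refinement order. -/
theorem bword_isMax (n : ℕ) (hn : 1 ≤ n) :
    IsHypExp n (bword n) ∧
    ∀ d : Fin (Nat.size n) → ℕ, IsHypExp n d → HypLe d (bword n) := by
  refine ⟨⟨fun i => ?_, sum_binary_digits _ n (Nat.lt_size_self n)⟩, fun d hd => ?_⟩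
  · have : bword n i < 2 := Nat.mod_lt _ two_pos
    omega
  · exact hypLe_binary_digits _ n (Nat.lt_size_self n) d hd.1 hd.2
end

section
/- For c, d ∈ D(n), the element d covers c in the refinement order (i.e., c < d and no e ∈ D(n) satisfies c < e < d) if and only if c is obtained from d by a single elementary move: there is an index i with d_i > 0 and d_{i+1} = 0 such that c agrees with d except that (c_i, c_{i+1}) = (d_i − 1, 2). -/
/-- `d` covers `c` in the refinement order on `D(n)`: `c < d` and no element of
`D(n)` lies strictly between them. -/
def IsCover (n : ℕ) (c d : Fin (Nat.size n) → ℕ) : Prop :=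
  HypLe c d ∧ c ≠ d ∧
    ∀ e, IsHypExp n e → HypLe c e → HypLe e d → e = c ∨ e = d

/-- An elementary move at `(i, j)` moves one unit of weight `w i` to two units of weight `w j`. -/
theorem sum_mul_add_of_move {k : ℕ} {c d : Fin k → ℕ} {i j : Fin k} (hij : i ≠ j)
    (hi : 0 < d i) (hj : d j = 0) (hci : c i = d i - 1) (hcj : c j = 2)
    (h : ∀ t, t ≠ i → t ≠ j → c t = d t) (w : Fin k → ℕ) :
    ∑ t, c t * w t + w i = ∑ t, d t * w t + 2 * w j := by
  have key : ∀ t, c t * w t + (if t = i then w i else 0)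
      = d t * w t + (if t = j then 2 * w j else 0) := by
    intro t
    by_cases hti : t = i
    · subst hti
      obtain ⟨a, ha⟩ := Nat.exists_eq_add_of_lt hi
      simp only [hci, ha, if_true, if_neg hij]
      simp only [Nat.zero_add, Nat.add_sub_cancel]
      ring
    · by_cases htj : t = j
      · subst htj
        simp [hcj, hj, hti]
      · simp [hti, htj, h t hti htj]
  have hsum := Finset.sum_congr (rfl : (Finset.univ : Finset (Fin k)) = Finset.univ)
    fun t _ => key t
  simpa [Finset.sum_add_distrib] using hsum

/-- An elementary move increases the digit sum by one. -/
theorem ElemMove.sum_eq {k : ℕ} {c d : Fin k → ℕ} (h : ElemMove d c) :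
    ∑ t, c t = ∑ t, d t + 1 := by
  obtain ⟨i, j, hij, hi, hj, hci, hcj, h⟩ := h
  have hne : i ≠ j := by rintro rfl; omega
  have := sum_mul_add_of_move hne hi hj hci hcj h fun _ => 1
  simp only [mul_one] at this
  omega

/-- Elementary moves preserve hyperbinary expansions of `n`. -/
theorem IsHypExp.of_elemMove {n : ℕ} {c d : Fin (Nat.size n) → ℕ} (hd : IsHypExp n d)
    (h : ElemMove d c) : IsHypExp n c := by
  obtain ⟨i, j, hij, hi, hj, hci, hcj, h⟩ := h
  have hne : i ≠ j := by rintro rfl; omega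
  refine ⟨fun t => ?_, ?_⟩
  · by_cases hti : t = i
    · subst hti
      have := hd.1 t
      omega
    · by_cases htj : t = j
      · subst htj
        omega
      · rw [h t hti htj]
        exact hd.1 t
  · have hsum := sum_mul_add_of_move hne hi hj hci hcj h
      fun t => 2 ^ (Nat.size n - 1 - (t : ℕ))
    have hexp : Nat.size n - 1 - (i : ℕ) = (Nat.size n - 1 - (j : ℕ)) + 1 := by
      have := j.isLt
      omega
    have hpow : 2 ^ (Nat.size n - 1 - (i : ℕ)) = 2 * 2 ^ (Nat.size n - 1 - (j : ℕ)) := by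
      rw [hexp, pow_succ']
    have hn := hd.2
    omega

/-- Strictly smaller elements in the refinement order have strictly larger digit sum. -/
theorem HypLe.eq_or_sum_lt {k : ℕ} {c d : Fin k → ℕ} (h : HypLe c d) :
    c = d ∨ ∑ t, d t < ∑ t, c t := by
  induction h with
  | refl => exact Or.inl rfl
  | tail _ hmove ih =>
    have := hmove.sum_eq
    rcases ih with rfl | ih
    · right; omega
    · right; omega

/-- For `c, d ∈ D(n)`: `d` covers `c` in the refinement order if and only if `c` is
obtained from `d` by a single elementary move. -/
theorem cover_iff_elemMove (n : ℕ) (c d : Fin (Nat.size n) → ℕ)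
    (hc : IsHypExp n c) (hd : IsHypExp n d) :
    IsCover n c d ↔ ElemMove d c := by
  constructor
  · rintro ⟨hle, hne, hcov⟩
    obtain heq | ⟨e, hce, hmove⟩ := Relation.ReflTransGen.cases_tail hle
    · exact absurd heq.symm hne
    · rcases hcov e (hd.of_elemMove hmove) hce (Relation.ReflTransGen.single hmove) with rfl | rfl
      · exact hmove
      · have := hmove.sum_eq
        omega
  · intro hmove
    have hsum := hmove.sum_eq
    refine ⟨Relation.ReflTransGen.single hmove, ?_, fun e _ hce hed => ?_⟩
    · rintro rfl
      omega
    · rcases hce.eq_or_sum_lt with rfl | hlt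
      · exact Or.inl rfl
      · rcases hed.eq_or_sum_lt with rfl | hlt'
        · exact Or.inr rfl
        · omega
end

section
/- Let ≤ and ⪯ be two partial orders on the same finite set P. Assume that for all x, y ∈ P with x ⪯ y, at least one of the following holds: x = y; or there exists z ∈ P with x < z (strictly, in ≤) and z ⪯ y; or there exists w ∈ P with x ⪯ w and w < y (strictly, in ≤). Then for all x, y ∈ P, x ⪯ y implies x ≤ y. -/
/-- The strict part of a partial order on a finite type is well-founded. -/
theorem wellFounded_strict_of_finite {P : Type*} [Finite P] (r : P → P → Prop)
    [IsPartialOrder P r] : WellFounded fun a b => r a b ∧ a ≠ b :=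
  haveI : IsTrans P fun a b => r a b ∧ a ≠ b :=
    ⟨fun _ _ _ hab hbc => ⟨_root_.trans hab.1 hbc.1, by
      rintro rfl
      exact hab.2 (antisymm hab.1 hbc.1)⟩⟩
  haveI : Std.Irrefl fun a b : P => r a b ∧ a ≠ b := ⟨fun _ ha => ha.2 rfl⟩
  Finite.wellFounded_of_trans_of_irrefl _

/-- The strict part of a partial order on a finite type is well-founded in reverse. -/
theorem wellFounded_flip_strict_of_finite {P : Type*} [Finite P] (r : P → P → Prop)
    [IsPartialOrder P r] : WellFounded fun b a => r a b ∧ a ≠ b :=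
  haveI : IsTrans P fun b a => r a b ∧ a ≠ b :=
    ⟨fun _ _ _ hab hbc => ⟨_root_.trans hbc.1 hab.1, by
      rintro rfl
      exact hab.2 (antisymm hab.1 hbc.1)⟩⟩
  haveI : Std.Irrefl fun b a : P => r a b ∧ a ≠ b := ⟨fun _ ha => ha.2 rfl⟩
  Finite.wellFounded_of_trans_of_irrefl _

/-- Let `≤` (`le1`) and `⪯` (`le2`) be two partial orders on the same finite set `P`.
If for all `x ⪯ y` either `x = y`, or there is `z` with `x < z` and `z ⪯ y`, or there
is `w` with `x ⪯ w` and `w < y` (where `<` is the strict order of `le1`), then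
`x ⪯ y` implies `x ≤ y` for all `x, y`. -/
theorem le2_implies_le1_of_interpolation (P : Type*) [Finite P]
    (le1 le2 : P → P → Prop)
    (h1 : IsPartialOrder P le1) (h2 : IsPartialOrder P le2)
    (h : ∀ x y, le2 x y →
      x = y ∨
      (∃ z, (le1 x z ∧ x ≠ z) ∧ le2 z y) ∨
      (∃ w, le2 x w ∧ (le1 w y ∧ w ≠ y))) :
    ∀ x y, le2 x y → le1 x y := by
  intro x y
  refine Prod.GameAdd.recursion (C := fun x y => le2 x y → le1 x y)
    (wellFounded_flip_strict_of_finite le1) (wellFounded_strict_of_finite le1) ?_ x y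
  intro x y ih hxy
  rcases h x y hxy with rfl | ⟨z, hxz, hzy⟩ | ⟨w, hxw, hwy⟩
  · exact refl_of le1 x
  · exact _root_.trans hxz.1 (ih z y (Prod.GameAdd.fst hxz) hzy)
  · exact _root_.trans (ih x w (Prod.GameAdd.snd hwy) hxw) hwy.1
end

section
/- For c, d ∈ D(n): c ≤ d in the refinement order if and only if s_i(c) ≤ s_i(d) for all 1 ≤ i ≤ k, where s_i(d) = Σ_{j=1}^i d_j·2^{i−j}. -/
/-- `psum d i` is the partial sum `s_{i+1}(d) = Σ_{j=1}^{i+1} d_j 2^{(i+1)-j}`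
(with `0`-indexed `i`, i.e. `psum d i = Σ_{j ≤ i} d_j 2^{i-j}`). -/
def psum {k : ℕ} (d : Fin k → ℕ) (i : ℕ) : ℕ :=
  ∑ j ∈ Finset.range (i + 1), if h : j < k then d ⟨j, h⟩ * 2 ^ (i - j) else 0

theorem psum_zero {k : ℕ} (d : Fin k → ℕ) (h : 0 < k) : psum d 0 = d ⟨0, h⟩ := by
  simp [psum, h]

theorem psum_succ {k : ℕ} (d : Fin k → ℕ) {i : ℕ} (h : i + 1 < k) :
    psum d (i + 1) = 2 * psum d i + d ⟨i + 1, h⟩ := by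
  unfold psum
  rw [Finset.sum_range_succ, Finset.mul_sum]
  congr 1
  · refine Finset.sum_congr rfl fun j hj => ?_
    have hji : j ≤ i := Nat.lt_succ_iff.mp (Finset.mem_range.mp hj)
    split_ifs
    · rw [Nat.succ_sub hji, pow_succ]
      ring
    · rfl
  · simp [h]

theorem IsHypExp.psum_last {n : ℕ} {d : Fin (Nat.size n) → ℕ} (hn : 1 ≤ n)
    (hd : IsHypExp n d) : psum d (Nat.size n - 1) = n := by
  have hk : Nat.size n - 1 + 1 = Nat.size n := Nat.sub_add_cancel (Nat.size_pos.mpr hn)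
  rw [psum, hk, Finset.sum_range]
  simpa using hd.2

theorem psum_injective {k : ℕ} {c d : Fin k → ℕ} (h : ∀ i < k, psum c i = psum d i) :
    c = d := by
  funext ⟨t, ht⟩
  have h₁ := h t ht
  cases t with
  | zero => rwa [psum_zero c ht, psum_zero d ht] at h₁
  | succ t =>
    have h₀ := h t (by omega)
    rw [psum_succ c ht, psum_succ d ht] at h₁
    omega

/-- An elementary move lowers exactly one partial sum, by one. -/
theorem psum_move {k : ℕ} {d c : Fin k → ℕ} {i j : Fin k} (hij : (j : ℕ) = (i : ℕ) + 1)
    (hi : 0 < d i) (hj : d j = 0) (hci : c i = d i - 1) (hcj : c j = 2)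
    (h : ∀ t, t ≠ i → t ≠ j → c t = d t) {t : ℕ} (ht : t < k) :
    psum c t + (if t = i then 1 else 0) = psum d t := by
  have other : ∀ (t : ℕ) (ht : t < k), t ≠ i → t ≠ j → c ⟨t, ht⟩ = d ⟨t, ht⟩ :=
    fun t ht h₁ h₂ => h _ (fun e => h₁ (congrArg Fin.val e)) (fun e => h₂ (congrArg Fin.val e))
  obtain ⟨i, hik⟩ := i
  obtain ⟨j, hjk⟩ := j
  dsimp only at hij other ⊢
  induction t with
  | zero =>
    rw [psum_zero c ht, psum_zero d ht]
    split_ifs with h₀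
    · subst h₀
      omega
    · exact other 0 ht h₀ (by omega)
  | succ t ih =>
    specialize ih (by omega)
    rw [psum_succ c ht, psum_succ d ht]
    by_cases h₁ : t + 1 = i
    · subst h₁
      simp only [if_neg (show t ≠ t + 1 by omega)] at ih
      simp only [if_true]
      omega
    · by_cases h₂ : t = i
      · subst h₂ hij
        simp only [if_true] at ih
        simp only [if_neg h₁]
        omega
      · have := other (t + 1) ht h₁ (by omega)
        simp only [if_neg h₂] at ih
        simp only [if_neg h₁]
        omega

theorem HypLe.psum_le {k : ℕ} {c d : Fin k → ℕ} (h : HypLe c d) {t : ℕ} (ht : t < k) :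
    psum c t ≤ psum d t := by
  induction h with
  | refl => exact le_rfl
  | tail _ hstep ih =>
    obtain ⟨i, j, hij, hi, hj, hci, hcj, ho⟩ := hstep
    have := psum_move hij hi hj hci hcj ho ht
    omega

/-- If the partial sums of `d` dominate those of `c`, with equal totals but `c ≠ d`, then an
elementary move is possible in `d` at a place where the domination is strict. -/
theorem exists_move {k : ℕ} {c d : Fin k → ℕ} (hc : ∀ i, c i ≤ 2)
    (hle : ∀ i < k, psum c i ≤ psum d i) (hlast : psum c (k - 1) = psum d (k - 1))
    (hne : c ≠ d) :
    ∃ (i : ℕ) (h : i + 1 < k), psum c i < psum d i ∧ 0 < d ⟨i, by omega⟩ ∧ d ⟨i + 1, h⟩ = 0 := by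
  classical
  by_contra! hno
  have hex : ∃ i, i < k ∧ psum c i < psum d i := by
    by_contra! hall
    exact hne (psum_injective fun i hi => le_antisymm (hle i hi) (hall i hi))
  obtain ⟨hmk, hmlt⟩ := Nat.find_spec hex
  have hmin := fun t => @Nat.find_min _ _ hex t
  generalize Nat.find hex = m at hmk hmlt hmin
  have hmpos : 0 < d ⟨m, hmk⟩ := by
    cases m with
    | zero =>
      rw [psum_zero c hmk, psum_zero d hmk] at hmlt
      omega
    | succ m =>
      have h₀ : ¬ psum c m < psum d m := fun h => hmin m (by omega) ⟨by omega, h⟩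
      rw [psum_succ c hmk, psum_succ d hmk] at hmlt
      omega
  have hall : ∀ t, m ≤ t → ∀ ht : t < k, psum c t < psum d t ∧ 0 < d ⟨t, ht⟩ := by
    intro t hmt
    induction t, hmt using Nat.le_induction with
    | base => exact fun _ => ⟨hmlt, hmpos⟩
    | succ t _ ih =>
      intro ht
      obtain ⟨h₁, h₂⟩ := ih (by omega)
      have h₃ := hno t ht h₁ h₂
      have h₄ := hc ⟨t + 1, ht⟩
      rw [psum_succ c ht, psum_succ d ht]
      omega
  have := (hall (k - 1) (by omega) (by omega)).1
  omega

theorem hypLe_of_psum_le {k : ℕ} {c d : Fin k → ℕ} (hc : ∀ i, c i ≤ 2)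
    (hle : ∀ i < k, psum c i ≤ psum d i) (hlast : psum c (k - 1) = psum d (k - 1)) :
    HypLe c d := by
  induction hN : ∑ i ∈ Finset.range k, psum d i using Nat.strong_induction_on generalizing d with
  | _ N ih =>
    by_cases hne : c = d
    · exact hne ▸ Relation.ReflTransGen.refl
    obtain ⟨i, hi, hlt, hpos, hzero⟩ := exists_move hc hle hlast hne
    let p : Fin k := ⟨i, by omega⟩
    let q : Fin k := ⟨i + 1, hi⟩
    let e : Fin k → ℕ := Function.update (Function.update d p (d p - 1)) q 2
    have hpq : p ≠ q := by simp [p, q]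
    have hep : e p = d p - 1 := by simp [e, hpq]
    have heq : e q = 2 := by simp [e]
    have heo : ∀ t, t ≠ p → t ≠ q → e t = d t := fun t h₁ h₂ => by simp [e, h₁, h₂]
    have hmove : ∀ t < k, psum e t + (if t = i then 1 else 0) = psum d t :=
      fun t ht => psum_move (i := p) (j := q) rfl hpos hzero hep heq heo ht
    have hlow : ∀ t < k, psum e t ≤ psum d t := fun t ht => by
      have := hmove t ht
      omega
    have hsum : ∑ t ∈ Finset.range k, psum e t < N := by
      rw [← hN]
      refine Finset.sum_lt_sum (fun t ht => hlow t (Finset.mem_range.mp ht))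
        ⟨i, Finset.mem_range.mpr (by omega), ?_⟩
      have := hmove i (by omega)
      simp only [if_true] at this
      omega
    refine Relation.ReflTransGen.tail (ih _ hsum (fun t ht => ?_) ?_ rfl)
      ⟨p, q, rfl, hpos, hzero, hep, heq, heo⟩
    · have h₁ := hmove t ht
      have h₂ := hle t ht
      split_ifs at h₁ with h₃
      · subst h₃
        omega
      · omega
    · have h₁ := hmove (k - 1) (by omega)
      rw [if_neg (by omega)] at h₁
      omega

/-- For `c, d ∈ D(n)`: `c ≤ d` in the refinement order if and only if
`s_i(c) ≤ s_i(d)` for all `1 ≤ i ≤ k` (here `psum · i` is `s_{i+1}`, `0`-indexed). -/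
theorem hypLe_iff_psum_le (n : ℕ) (hn : 1 ≤ n) (c d : Fin (Nat.size n) → ℕ)
    (hc : IsHypExp n c) (hd : IsHypExp n d) :
    HypLe c d ↔ ∀ i < Nat.size n, psum c i ≤ psum d i := by
  refine ⟨fun h i hi => h.psum_le hi, fun h => hypLe_of_psum_le hc.1 h ?_⟩
  rw [hc.psum_last hn, hd.psum_last hn]
end
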